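/- Let n ≥ 3, let B be a nondegenerate symmetric bilinear form on ℝⁿ, let U ⊆ ℝⁿ be a nonempty open connected set, and let ξ₁, ξ₂ be smooth conformal Killing vectors of B on U with conformal factors Ψ₁, Ψ₂ respectively. Suppose that at some point p ∈ U: (1) ξ₁(p) = ξ₂(p); (2) the B-antisymmetric parts of Dξ₁(p) and Dξ₂(p) agree, i.e. B(Dξ₁(p)u, v) − B(Dξ₁(p)v, u) = B(Dξ₂(p)u, v) − B(Dξ₂(p)v, u) for all u,v ∈ ℝⁿ; (3) Ψ₁(p) = Ψ₂(p); and (4) DΨ₁(p) = DΨ₂(p). Then ξ₁ = ξ₂ on all of U. -/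

import Mathlib

section ConformalKilling

variable {E : Type*} [NormedAddCommGroup E] [NormedSpace ℝ E]

/-- `ξ` satisfies the conformal Killing equation for `B` on `U` with conformal factor `Ψ`. -/
def IsConformalKillingOn (B : E →ₗ[ℝ] E →ₗ[ℝ] ℝ) (ξ : E → E) (Ψ : E → ℝ) (U : Set E) : Prop :=
  ∀ x ∈ U, ∀ u v, B (fderiv ℝ ξ x u) v + B u (fderiv ℝ ξ x v) = 2 * Ψ x * B u v

theorem IsConformalKillingOn.sub {B : E →ₗ[ℝ] E →ₗ[ℝ] ℝ} {ξ₁ ξ₂ : E → E} {Ψ₁ Ψ₂ : E → ℝ}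
    {U : Set E} (h₁ : IsConformalKillingOn B ξ₁ Ψ₁ U) (h₂ : IsConformalKillingOn B ξ₂ Ψ₂ U)
    (hd₁ : ∀ x ∈ U, DifferentiableAt ℝ ξ₁ x) (hd₂ : ∀ x ∈ U, DifferentiableAt ℝ ξ₂ x) :
    IsConformalKillingOn B (ξ₁ - ξ₂) (Ψ₁ - Ψ₂) U := by
  intro x hx u v
  rw [fderiv_sub (hd₁ x hx) (hd₂ x hx)]
  simp only [sub_apply, map_sub, LinearMap.sub_apply, Pi.sub_apply]
  linear_combination h₁ x hx u v - h₂ x hx u v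

theorem exists_orthogonal_basis_apply_self_ne_zero [FiniteDimensional ℝ E]
    {B : E →ₗ[ℝ] E →ₗ[ℝ] ℝ} (hSymm : ∀ u v, B u v = B v u)
    (hNondeg : ∀ u, (∀ v, B u v = 0) → u = 0) :
    ∃ b : Module.Basis (Fin (Module.finrank ℝ E)) ℝ E,
      (∀ i j, i ≠ j → B (b i) (b j) = 0) ∧ ∀ i, B (b i) (b i) ≠ 0 := by
  obtain ⟨b, hb⟩ := LinearMap.BilinForm.exists_orthogonal_basis (B := B) ⟨hSymm⟩
  exact ⟨b, fun i j hij => hb hij, hb.not_isOrtho_basis_self_of_separatingLeft hNondeg⟩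

/-- In dimension at least three a bilinear form with vanishing Kulkarni–Nomizu product with a
nondegenerate symmetric form is zero. -/
theorem eq_zero_of_kulkarniNomizu_eq_zero [FiniteDimensional ℝ E]
    (hn : 3 ≤ Module.finrank ℝ E) {B : E →ₗ[ℝ] E →ₗ[ℝ] ℝ} (hSymm : ∀ u v, B u v = B v u)
    (hNondeg : ∀ u, (∀ v, B u v = 0) → u = 0) {H : E →ₗ[ℝ] E →ₗ[ℝ] ℝ}
    (hH : ∀ a u v w, H a v * B u w - H a w * B u v = H u v * B a w - H u w * B a v) :
    H = 0 := by
  obtain ⟨b, hb, hb'⟩ := exists_orthogonal_basis_apply_self_ne_zero hSymm hNondeg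
  have third (i j : Fin (Module.finrank ℝ E)) : ∃ k, k ≠ i ∧ k ≠ j := by
    obtain ⟨k, hk⟩ := Finset.exists_mem_notMem_of_card_lt_card
      (s := {i, j}) (t := Finset.univ) (by
        have := Finset.card_le_two (a := i) (b := j)
        rw [Finset.card_univ, Fintype.card_fin]
        lia)
    exact ⟨k, by simpa using hk⟩
  have diag {i k} (hik : i ≠ k) :
      H (b i) (b i) * B (b k) (b k) = -(H (b k) (b k) * B (b i) (b i)) := by
    simpa [hb i k hik, hb k i hik.symm] using hH (b i) (b k) (b i) (b k)
  refine b.ext fun i => b.ext fun j => ?_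
  obtain ⟨k, hki, hkj⟩ := third i j
  simp only [LinearMap.zero_apply]
  rcases eq_or_ne i j with rfl | hij
  · obtain ⟨l, hli, hlk⟩ := third i k
    have h₁ := diag hki.symm
    have h₂ := diag hli.symm
    have h₃ := diag hlk
    have : 2 * (B (b k) (b k) * B (b l) (b l)) * H (b i) (b i) = 0 := by
      linear_combination B (b l) (b l) * h₁ + B (b k) (b k) * h₂ - B (b i) (b i) * h₃
    simpa [hb'] using this
  · have := hH (b i) (b k) (b j) (b k)
    simpa [hb k j hkj, hb i k hki.symm, hb i j hij, hb'] using this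

theorem fderiv_bilin_clm_apply [FiniteDimensional ℝ E] (B : E →ₗ[ℝ] E →ₗ[ℝ] ℝ)
    {F : E → E →L[ℝ] E} {x : E} (hF : DifferentiableAt ℝ F x) (u v w : E) :
    DifferentiableAt ℝ (fun y => B (F y v) w) x ∧
      fderiv ℝ (fun y => B (F y v) w) x u = B (fderiv ℝ F x u v) w := by
  have h := (LinearMap.toContinuousLinearMap (B.flip w)).hasFDerivAt.comp x
    (hF.hasFDerivAt.clm_apply (hasFDerivAt_const v x))
  refine ⟨h.differentiableAt, ?_⟩
  have h' : fderiv ℝ (fun y => B (F y v) w) x = _ := h.fderiv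
  rw [h']
  simp

theorem fderiv_clm_apply_const {G : Type*} [NormedAddCommGroup G] [NormedSpace ℝ G]
    {F : E → E →L[ℝ] G} {x : E} (hF : DifferentiableAt ℝ F x) (u v : E) :
    fderiv ℝ (fun y => F y v) x u = fderiv ℝ F x u v := by
  rw [fderiv_clm_apply hF (differentiableAt_const v)]
  simp

namespace IsConformalKillingOn

variable [FiniteDimensional ℝ E] {B : E →ₗ[ℝ] E →ₗ[ℝ] ℝ} {ξ : E → E} {Ψ : E → ℝ} {U : Set E}

theorem contDiffOn_factor [Nontrivial E] (h : IsConformalKillingOn B ξ Ψ U)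
    (hNondeg : ∀ u, (∀ v, B u v = 0) → u = 0) (hU : IsOpen U) {m : WithTop ℕ∞}
    (hξ : ContDiffOn ℝ (m + 1) ξ U) : ContDiffOn ℝ m Ψ U := by
  obtain ⟨u, hu⟩ := exists_ne (0 : E)
  obtain ⟨v, hv⟩ : ∃ v, B u v ≠ 0 := by
    by_contra! hc
    exact hu (hNondeg u hc)
  have hF : ContDiffOn ℝ m (fderiv ℝ ξ) U := hξ.fderiv_of_isOpen hU le_rfl
  have h₁ : ContDiffOn ℝ m (fun x => B (fderiv ℝ ξ x u) v) U :=
    (LinearMap.toContinuousLinearMap (B.flip v)).contDiff.comp_contDiffOn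
      (hF.clm_apply contDiffOn_const)
  have h₂ : ContDiffOn ℝ m (fun x => B u (fderiv ℝ ξ x v)) U :=
    (LinearMap.toContinuousLinearMap (B u)).contDiff.comp_contDiffOn
      (hF.clm_apply contDiffOn_const)
  refine ((h₁.add h₂).div_const (2 * B u v)).congr fun x hx => ?_
  rw [h x hx u v]
  field_simp

/-- The second derivative of a conformal Killing vector in terms of its conformal factor. -/
theorem bilin_fderiv_fderiv (h : IsConformalKillingOn B ξ Ψ U)
    (hSymm : ∀ u v, B u v = B v u) (hU : IsOpen U) (hξ : ContDiffOn ℝ 2 ξ U)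
    (hΨ : DifferentiableOn ℝ Ψ U) {x : E} (hx : x ∈ U) (u v w : E) :
    B (fderiv ℝ (fderiv ℝ ξ) x u v) w =
      fderiv ℝ Ψ x u * B v w + fderiv ℝ Ψ x v * B u w - fderiv ℝ Ψ x w * B u v := by
  have hxU := hU.mem_nhds hx
  have hF : DifferentiableAt ℝ (fderiv ℝ ξ) x :=
    ((hξ.fderiv_of_isOpen hU (m := 1) (by norm_num)).differentiableOn
      one_ne_zero).differentiableAt hxU
  have symm (a b : E) : fderiv ℝ (fderiv ℝ ξ) x a b = fderiv ℝ (fderiv ℝ ξ) x b a :=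
    (hξ.contDiffAt hxU).isSymmSndFDerivAt (by simp) a b
  have first (a b c : E) : B (fderiv ℝ (fderiv ℝ ξ) x a b) c
      + B (fderiv ℝ (fderiv ℝ ξ) x a c) b = 2 * (fderiv ℝ Ψ x a * B b c) := by
    have heq : (fun y => B (fderiv ℝ ξ y b) c + B (fderiv ℝ ξ y c) b)
        =ᶠ[nhds x] fun y => 2 * B b c * Ψ y := by
      filter_upwards [hxU] with y hy
      rw [hSymm (fderiv ℝ ξ y c) b, h y hy b c]
      ring
    have hd := congrArg (fun L : E →L[ℝ] ℝ => L a) heq.fderiv_eq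
    obtain ⟨d₁, e₁⟩ := fderiv_bilin_clm_apply B hF a b c
    obtain ⟨d₂, e₂⟩ := fderiv_bilin_clm_apply B hF a c b
    rw [fderiv_fun_add d₁ d₂, fderiv_const_mul (hΨ.differentiableAt hxU),
      add_apply, e₁, e₂, smul_apply, smul_eq_mul] at hd
    linear_combination hd
  have h₁ := first u v w
  have h₂ := first v u w
  have h₃ := first w u v
  rw [symm v u, hSymm] at h₂
  rw [symm w u, symm w v] at h₃
  rw [hSymm w] at h₂
  linear_combination (h₁ + h₂ - h₃) / 2

theorem fderiv_fderiv_factor_eq_zero (h : IsConformalKillingOn B ξ Ψ U)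
    (hn : 3 ≤ Module.finrank ℝ E) (hSymm : ∀ u v, B u v = B v u)
    (hNondeg : ∀ u, (∀ v, B u v = 0) → u = 0) (hU : IsOpen U) (hξ : ContDiffOn ℝ 3 ξ U)
    {x : E} (hx : x ∈ U) : fderiv ℝ (fderiv ℝ Ψ) x = 0 := by
  have : Nontrivial E := Module.nontrivial_of_finrank_pos (R := ℝ) (by lia)
  have hΨ : ContDiffOn ℝ 2 Ψ U := h.contDiffOn_factor hNondeg hU (hξ.of_le (by norm_num))
  have hxU := hU.mem_nhds hx
  have hF : ContDiffOn ℝ 2 (fderiv ℝ ξ) U := hξ.fderiv_of_isOpen hU (by norm_num)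
  have hG : DifferentiableAt ℝ (fderiv ℝ (fderiv ℝ ξ)) x :=
    ((hF.fderiv_of_isOpen hU (m := 1) (by norm_num)).differentiableOn
      one_ne_zero).differentiableAt hxU
  have hP : DifferentiableAt ℝ (fderiv ℝ Ψ) x :=
    ((hΨ.fderiv_of_isOpen hU (m := 1) (by norm_num)).differentiableOn
      one_ne_zero).differentiableAt hxU
  have third (a u v w : E) : B (fderiv ℝ (fderiv ℝ (fderiv ℝ ξ)) x a u v) w =
      fderiv ℝ (fderiv ℝ Ψ) x a u * B v w + fderiv ℝ (fderiv ℝ Ψ) x a v * B u w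
        - fderiv ℝ (fderiv ℝ Ψ) x a w * B u v := by
    have hGu : DifferentiableAt ℝ (fun y => fderiv ℝ (fderiv ℝ ξ) y u) x :=
      hG.clm_apply (differentiableAt_const u)
    have heq : (fun y => B (fderiv ℝ (fderiv ℝ ξ) y u v) w) =ᶠ[nhds x]
        fun y => fderiv ℝ Ψ y u * B v w + fderiv ℝ Ψ y v * B u w - fderiv ℝ Ψ y w * B u v := by
      filter_upwards [hxU] with y hy
      exact h.bilin_fderiv_fderiv hSymm hU (hξ.of_le (by norm_num))
        (hΨ.differentiableOn two_ne_zero) hy u v w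
    have hd := congrArg (fun L : E →L[ℝ] ℝ => L a) heq.fderiv_eq
    have hPd (z : E) : DifferentiableAt ℝ (fun y => fderiv ℝ Ψ y z) x :=
      hP.clm_apply (differentiableAt_const z)
    rw [(fderiv_bilin_clm_apply B hGu a v w).2, fderiv_clm_apply_const hG,
      fderiv_fun_sub (((hPd u).mul_const _).fun_add ((hPd v).mul_const _)) ((hPd w).mul_const _),
      fderiv_fun_add ((hPd u).mul_const _) ((hPd v).mul_const _), fderiv_mul_const (hPd u),
      fderiv_mul_const (hPd v), fderiv_mul_const (hPd w)] at hd
    simp only [sub_apply, add_apply,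
      smul_apply, smul_eq_mul, fderiv_clm_apply_const hP] at hd
    linear_combination hd
  have key := eq_zero_of_kulkarniNomizu_eq_zero hn hSymm hNondeg
    (H := (fderiv ℝ (fderiv ℝ Ψ) x).toLinearMap₁₂) (fun a u v w => by
      have h₁ := third a u v w
      have h₂ := third u a v w
      rw [(hF.contDiffAt hxU).isSymmSndFDerivAt (by simp) u a] at h₂
      have h₃ := (hΨ.contDiffAt hxU).isSymmSndFDerivAt (by simp) a u
      change fderiv ℝ (fderiv ℝ Ψ) x a v * B u w - fderiv ℝ (fderiv ℝ Ψ) x a w * B u v =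
        fderiv ℝ (fderiv ℝ Ψ) x u v * B a w - fderiv ℝ (fderiv ℝ Ψ) x u w * B a v
      linear_combination h₂ - h₁ - B v w * h₃)
  ext a u
  simpa using LinearMap.congr_fun₂ key a u

/-- A conformal Killing vector vanishes if its value, the antisymmetric part of its derivative, its
conformal factor and the differential of the latter vanish at a point. -/
theorem eqOn_zero (h : IsConformalKillingOn B ξ Ψ U)
    (hn : 3 ≤ Module.finrank ℝ E) (hSymm : ∀ u v, B u v = B v u)
    (hNondeg : ∀ u, (∀ v, B u v = 0) → u = 0) (hU : IsOpen U) (hU' : IsPreconnected U)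
    (hξ : ContDiffOn ℝ 3 ξ U) {p : E} (hp : p ∈ U) (hξp : ξ p = 0)
    (hanti : ∀ u v, B (fderiv ℝ ξ p u) v = B (fderiv ℝ ξ p v) u) (hΨp : Ψ p = 0)
    (hdΨp : fderiv ℝ Ψ p = 0) : Set.EqOn ξ 0 U := by
  have : Nontrivial E := Module.nontrivial_of_finrank_pos (R := ℝ) (by lia)
  have hΨ : ContDiffOn ℝ 2 Ψ U := h.contDiffOn_factor hNondeg hU (hξ.of_le (by norm_num))
  have hP : DifferentiableOn ℝ (fderiv ℝ Ψ) U :=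
    (hΨ.fderiv_of_isOpen hU (m := 1) (by norm_num)).differentiableOn one_ne_zero
  have hF : DifferentiableOn ℝ (fderiv ℝ ξ) U :=
    (hξ.fderiv_of_isOpen hU (m := 1) (by norm_num)).differentiableOn one_ne_zero
  have hdΨ (x) (hx : x ∈ U) : fderiv ℝ Ψ x = 0 :=
    (hU.is_const_of_fderiv_eq_zero hU' hP
      (fun y hy => h.fderiv_fderiv_factor_eq_zero hn hSymm hNondeg hU hξ hy) hx hp).trans hdΨp
  have hdξp : fderiv ℝ ξ p = 0 := by
    ext1 u
    refine hNondeg _ fun v => ?_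
    have := h p hp u v
    rw [hΨp, hSymm u] at this
    linear_combination this / 2 + hanti u v / 2
  have hdξ (x) (hx : x ∈ U) : fderiv ℝ ξ x = 0 := by
    refine (hU.is_const_of_fderiv_eq_zero hU' hF (fun y hy => ?_) hx hp).trans hdξp
    ext u v : 2
    refine hNondeg _ fun w => ?_
    rw [h.bilin_fderiv_fderiv hSymm hU (hξ.of_le (by norm_num))
      (hΨ.differentiableOn two_ne_zero) hy, hdΨ y hy]
    simp
  exact fun x hx => (hU.is_const_of_fderiv_eq_zero hU' (hξ.differentiableOn three_ne_zero)
    hdξ hx hp).trans hξp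

end IsConformalKillingOn

end ConformalKilling

/-- Two smooth conformal Killing vectors of a flat metric `B` on a nonempty open
connected set `U` (`n ≥ 3`) that agree at a point `p` together with the antisymmetric
part of their first derivative, the conformal factor and its differential at `p`,
coincide on all of `U`. -/
theorem stmt_5 (n : ℕ) (hn : 3 ≤ n)
    (B : (Fin n → ℝ) →ₗ[ℝ] (Fin n → ℝ) →ₗ[ℝ] ℝ)
    (hSymm : ∀ u v, B u v = B v u)
    (hNondeg : ∀ u, (∀ v, B u v = 0) → u = 0)
    (U : Set (Fin n → ℝ)) (hUopen : IsOpen U) (hUconn : IsConnected U)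
    (ξ₁ ξ₂ : (Fin n → ℝ) → (Fin n → ℝ)) (Ψ₁ Ψ₂ : (Fin n → ℝ) → ℝ)
    (hξ₁smooth : ContDiffOn ℝ (⊤ : ℕ∞) ξ₁ U) (hξ₂smooth : ContDiffOn ℝ (⊤ : ℕ∞) ξ₂ U)
    (hCKV₁ : ∀ x ∈ U, ∀ u v,
      B (fderiv ℝ ξ₁ x u) v + B u (fderiv ℝ ξ₁ x v) = 2 * Ψ₁ x * B u v)
    (hCKV₂ : ∀ x ∈ U, ∀ u v,
      B (fderiv ℝ ξ₂ x u) v + B u (fderiv ℝ ξ₂ x v) = 2 * Ψ₂ x * B u v)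
    (p : Fin n → ℝ) (hp : p ∈ U)
    (h1 : ξ₁ p = ξ₂ p)
    (h2 : ∀ u v, B (fderiv ℝ ξ₁ p u) v - B (fderiv ℝ ξ₁ p v) u
        = B (fderiv ℝ ξ₂ p u) v - B (fderiv ℝ ξ₂ p v) u)
    (h3 : Ψ₁ p = Ψ₂ p)
    (h4 : fderiv ℝ Ψ₁ p = fderiv ℝ Ψ₂ p) :
    ∀ x ∈ U, ξ₁ x = ξ₂ x := by
  have hle : (3 : WithTop ℕ∞) ≤ ((⊤ : ℕ∞) : WithTop ℕ∞) :=
    WithTop.coe_le_coe.2 (le_top : (3 : ℕ∞) ≤ ⊤)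
  have hξ₁ := hξ₁smooth.of_le hle
  have hξ₂ := hξ₂smooth.of_le hle
  have hd₁ (x) (hx : x ∈ U) : DifferentiableAt ℝ ξ₁ x :=
    (hξ₁.differentiableOn three_ne_zero).differentiableAt (hUopen.mem_nhds hx)
  have hd₂ (x) (hx : x ∈ U) : DifferentiableAt ℝ ξ₂ x :=
    (hξ₂.differentiableOn three_ne_zero).differentiableAt (hUopen.mem_nhds hx)
  have hc₁ : IsConformalKillingOn B ξ₁ Ψ₁ U := hCKV₁
  have hc₂ : IsConformalKillingOn B ξ₂ Ψ₂ U := hCKV₂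
  have : Nontrivial (Fin n → ℝ) :=
    Module.nontrivial_of_finrank_pos (R := ℝ) (by rw [Module.finrank_fin_fun]; lia)
  have hΨ₁ : ContDiffOn ℝ 2 Ψ₁ U :=
    hc₁.contDiffOn_factor hNondeg hUopen (hξ₁.of_le (by norm_num))
  have hΨ₂ : ContDiffOn ℝ 2 Ψ₂ U :=
    hc₂.contDiffOn_factor hNondeg hUopen (hξ₂.of_le (by norm_num))
  have hpU := hUopen.mem_nhds hp
  have key := (hc₁.sub hc₂ hd₁ hd₂).eqOn_zero (by rwa [Module.finrank_fin_fun]) hSymm hNondeg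
    hUopen hUconn.isPreconnected (hξ₁.sub hξ₂) hp (sub_eq_zero.2 h1)
    (fun u v => by
      rw [fderiv_sub (hd₁ p hp) (hd₂ p hp)]
      simp only [sub_apply, map_sub, LinearMap.sub_apply]
      linear_combination h2 u v)
    (sub_eq_zero.2 h3)
    (by
      rw [fderiv_sub ((hΨ₁.differentiableOn two_ne_zero).differentiableAt hpU)
        ((hΨ₂.differentiableOn two_ne_zero).differentiableAt hpU), h4, sub_self])
  exact fun x hx => sub_eq_zero.1 (key hx)
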